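/- arXiv:0911.3305 — 2 statements merged into one kernel-verified Lean document; each statement's English description precedes it below -/
import Mathlib

section
/- In the monoid M_Bii, if a·X = c·Y for elements X, Y of M_Bii, then there exists an element Z of M_Bii such that X = c·Z and Y = a·Z. -/
/-- The three generators of the monoid `M_Bii`. -/
inductive BiiGen : Type
  | a | b | c

open FreeMonoid in
/-- The positive homogeneous relations `cbb = bba`, `bc = ab`, `ac = ca`. -/
def biiRel : FreeMonoid BiiGen → FreeMonoid BiiGen → Prop := fun x y =>
  (x = of .c * of .b * of .b ∧ y = of .b * of .b * of .a) ∨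
  (x = of .b * of .c ∧ y = of .a * of .b) ∨
  (x = of .a * of .c ∧ y = of .c * of .a)

/-- The monoid `M_Bii`: quotient of the free monoid on `{a,b,c}` by the congruence
generated by the relations `cbb = bba`, `bc = ab`, `ac = ca`. -/
abbrev MBii : Type := (conGen biiRel).Quotient

/-- The image of the generator `a` in `M_Bii`. -/
def MBii.a : MBii := (conGen biiRel).mk' (FreeMonoid.of BiiGen.a)
/-- The image of the generator `b` in `M_Bii`. -/
def MBii.b : MBii := (conGen biiRel).mk' (FreeMonoid.of BiiGen.b)
/-- The image of the generator `c` in `M_Bii`. -/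
def MBii.c : MBii := (conGen biiRel).mk' (FreeMonoid.of BiiGen.c)

namespace MBii

theorem commute_a_c : Commute a c :=
  (Con.eq _).2 (ConGen.Rel.of _ _ (.inr (.inr ⟨rfl, rfl⟩)))

theorem semiconjBy_b : SemiconjBy b c a :=
  (Con.eq _).2 (ConGen.Rel.of _ _ (.inr (.inl ⟨rfl, rfl⟩)))

theorem semiconjBy_b_mul_b : SemiconjBy (b * b) a c := by
  have h : c * b * b = b * b * a := (Con.eq _).2 (ConGen.Rel.of _ _ (.inl ⟨rfl, rfl⟩))
  rw [SemiconjBy, ← h, mul_assoc]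

/-- Left multiplication by a generator, read off on the exponents `(k, p, q, r)` of the
normal form `MBii.ofExponents`. -/
def genAct : BiiGen → Function.End (ℕ × ℕ × ℕ × ℕ)
  | .a => fun (k, p, q, r) => (k, p + 1, q, r)
  | .b => fun (k, p, q, r) => (k + 1, q, r, p)
  | .c => fun (k, p, q, r) => (k, p, q + 1, r)

/-- The action of `M_Bii` on exponents, extending `MBii.genAct`. -/
def act : MBii →* Function.End (ℕ × ℕ × ℕ × ℕ) :=
  (conGen biiRel).lift (FreeMonoid.lift genAct) <| Con.conGen_le.2 <| by
    rintro x y (⟨rfl, rfl⟩ | ⟨rfl, rfl⟩ | ⟨rfl, rfl⟩) <;> rfl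

/-- The exponents of the normal form of an element of `M_Bii`. -/
def exponents (X : MBii) : ℕ × ℕ × ℕ × ℕ := act X (0, 0, 0, 0)

theorem exponents_mk_mul (g : BiiGen) (X : MBii) :
    exponents ((conGen biiRel).mk' (FreeMonoid.of g) * X) = genAct g (exponents X) := by
  rw [exponents, map_mul]
  rfl

/-- The normal form with given exponents: `a ^ p * c ^ q` when `k = 0`, where `r` is
expected to vanish, and `a ^ p * c ^ q * b * a ^ r * b ^ (k - 1)` otherwise. -/
def ofExponents : ℕ × ℕ × ℕ × ℕ → MBii
  | (0, p, q, _) => a ^ p * c ^ q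
  | (k + 1, p, q, r) => a ^ p * c ^ q * (b * (a ^ r * b ^ k))

theorem a_mul_ofExponents (k p q r : ℕ) :
    a * ofExponents (k, p, q, r) = ofExponents (k, p + 1, q, r) := by
  cases k <;> simp only [ofExponents, pow_succ', mul_assoc]

theorem c_mul_ofExponents (k p q r : ℕ) :
    c * ofExponents (k, p, q, r) = ofExponents (k, p, q + 1, r) := by
  have h (x : MBii) : c * (a ^ p * x) = a ^ p * (c * x) := by
    rw [← mul_assoc, ← (commute_a_c.pow_left p).eq, mul_assoc]
  cases k <;> simp only [ofExponents, pow_succ', mul_assoc, h]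

theorem b_mul_ofExponents (k p q r : ℕ) (hr : k = 0 → r = 0) :
    b * ofExponents (k, p, q, r) = ofExponents (k + 1, q, r, p) := by
  have hb (n : ℕ) : b * c ^ n = a ^ n * b := semiconjBy_b.pow_right n
  have hbb (n : ℕ) : b * b * a ^ n = c ^ n * (b * b) := semiconjBy_b_mul_b.pow_right n
  have hac (m n : ℕ) : a ^ m * c ^ n = c ^ n * a ^ m := commute_a_c.pow_pow m n
  cases k with
  | zero =>
    obtain rfl := hr rfl
    simp only [ofExponents, pow_zero, mul_one]
    rw [hac, ← mul_assoc, hb, mul_assoc]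
  | succ k =>
    simp only [ofExponents]
    calc b * (a ^ p * c ^ q * (b * (a ^ r * b ^ k)))
        = b * c ^ q * (a ^ p * b) * (a ^ r * b ^ k) := by rw [hac]; simp only [mul_assoc]
      _ = a ^ q * (b * b) * (c ^ p * a ^ r) * b ^ k := by rw [hb, ← hb p]; simp only [mul_assoc]
      _ = a ^ q * (b * b * a ^ r) * c ^ p * b ^ k := by rw [← hac]; simp only [mul_assoc]
      _ = a ^ q * c ^ r * b * (b * c ^ p) * b ^ k := by rw [hbb]; simp only [mul_assoc]
      _ = a ^ q * c ^ r * (b * (a ^ p * b ^ (k + 1))) := by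
        rw [hb, pow_succ']; simp only [mul_assoc]

theorem ofExponents_exponents_aux (X : MBii) :
    ((exponents X).1 = 0 → (exponents X).2.2.2 = 0) ∧ ofExponents (exponents X) = X := by
  induction X using Con.induction_on with | _ w
  induction w using FreeMonoid.inductionOn' with
  | one => exact ⟨fun _ => rfl, by
      change a ^ 0 * c ^ 0 = 1
      simp⟩
  | of_mul g w ih =>
    have h := exponents_mk_mul g (w : MBii)
    change exponents ((FreeMonoid.of g * w : FreeMonoid BiiGen) : MBii) = _ at h
    rw [h]
    obtain ⟨hr, hX⟩ := ih
    rw [Con.coe_mul]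
    nth_rw 4 [← hX]
    generalize exponents (w : MBii) = s at hr
    obtain ⟨k, p, q, r⟩ := s
    cases g with
    | a => exact ⟨hr, (a_mul_ofExponents k p q r).symm⟩
    | b => exact ⟨nofun, (b_mul_ofExponents k p q r hr).symm⟩
    | c => exact ⟨hr, (c_mul_ofExponents k p q r).symm⟩

theorem ofExponents_exponents (X : MBii) : ofExponents (exponents X) = X :=
  (ofExponents_exponents_aux X).2

end MBii

theorem MBii_aX_eq_cY (X Y : MBii) (h : MBii.a * X = MBii.c * Y) :
    ∃ Z : MBii, X = MBii.c * Z ∧ Y = MBii.a * Z := by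
  have hE : MBii.genAct .a X.exponents = MBii.genAct .c Y.exponents := by
    rw [← MBii.exponents_mk_mul, ← MBii.exponents_mk_mul]
    exact congrArg MBii.exponents h
  rw [← MBii.ofExponents_exponents X, ← MBii.ofExponents_exponents Y]
  generalize MBii.exponents X = s at hE
  generalize MBii.exponents Y = t at hE
  obtain ⟨k, p, q, r⟩ := s
  obtain ⟨k', p', q', r'⟩ := t
  simp only [MBii.genAct, Prod.mk.injEq] at hE
  obtain ⟨rfl, rfl, rfl, rfl⟩ := hE
  exact ⟨MBii.ofExponents (k, p, q', r), (MBii.c_mul_ofExponents k p q' r).symm,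
    (MBii.a_mul_ofExponents k p q' r).symm⟩
end

section
/- There exists an anti-isomorphism φ of the monoid M_Bii (that is, a bijection φ : M_Bii → M_Bii with φ(x·y) = φ(y)·φ(x) for all x, y; equivalently a multiplicative equivalence from M_Bii to its multiplicative opposite) such that φ(a) = c, φ(b) = b, and φ(c) = a. -/
/-- The action on generators of the anti-automorphism, exchanging `a` and `c`. -/
def BiiGen.swap : BiiGen → MBii
  | .a => MBii.c
  | .b => MBii.b
  | .c => MBii.a

namespace MBii

theorem c_mul_b_mul_b : c * b * b = b * b * a :=
  (Con.eq _).2 (.of _ _ (Or.inl ⟨rfl, rfl⟩))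

theorem b_mul_c : b * c = a * b :=
  (Con.eq _).2 (.of _ _ (Or.inr (Or.inl ⟨rfl, rfl⟩)))

theorem a_mul_c : a * c = c * a :=
  (Con.eq _).2 (.of _ _ (Or.inr (Or.inr ⟨rfl, rfl⟩)))

/-- The anti-endomorphism of `M_Bii` exchanging `a` and `c` and fixing `b`, as a homomorphism
to the opposite monoid. -/
def reverse : MBii →* MBiiᵐᵒᵖ :=
  (conGen biiRel).lift (FreeMonoid.lift fun g => MulOpposite.op g.swap) <| by
    refine Con.conGen_le.2 ?_
    rintro x y (⟨rfl, rfl⟩ | ⟨rfl, rfl⟩ | ⟨rfl, rfl⟩) <;>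
      simp only [Con.ker_rel, map_mul, FreeMonoid.lift_eval_of, ← MulOpposite.op_mul,
        BiiGen.swap, ← mul_assoc]
    · rw [c_mul_b_mul_b]
    · rw [b_mul_c]
    · rw [a_mul_c]

theorem unop_reverse_mul (x y : MBii) :
    (reverse (x * y)).unop = (reverse y).unop * (reverse x).unop := by
  rw [map_mul, MulOpposite.unop_mul]

theorem unop_reverse_involutive : Function.Involutive fun x : MBii => (reverse x).unop := by
  intro x
  induction x using Con.induction_on with | _ w
  induction w using FreeMonoid.inductionOn' with
  | one => rfl
  | of_mul g w ih =>
    have hg : (reverse (reverse ((FreeMonoid.of g : FreeMonoid BiiGen) : MBii)).unop).unop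
        = (FreeMonoid.of g : FreeMonoid BiiGen) := by cases g <;> rfl
    simp only [Con.coe_mul, unop_reverse_mul, hg] at ih ⊢
    rw [ih]

end MBii

/-- There is an anti-isomorphism of `M_Bii` sending `a ↦ c`, `b ↦ b`, `c ↦ a`. -/
theorem MBii_antiIso :
    ∃ φ : MBii ≃ MBii, (∀ x y : MBii, φ (x * y) = φ y * φ x) ∧
      φ MBii.a = MBii.c ∧ φ MBii.b = MBii.b ∧ φ MBii.c = MBii.a :=
  ⟨MBii.unop_reverse_involutive.toPerm, MBii.unop_reverse_mul, rfl, rfl, rfl⟩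
end
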